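/- EUKF-C covariance identities for linear systems: with B·Bᵀ = n·P, the EUKF-C covariances satisfy P_prior^EUKFC = A·P·Aᵀ + Q = P_prior, P_z^EUKFC = C·P_prior·Cᵀ + R, and P_ez^EUKFC = P_prior·Cᵀ; that is, all three equal the corresponding exact Kalman-filter covariances. -/

import Mathlib

open Matrix

/-- UKF weight vector `W ∈ ℝ^{2n+1}`. -/
noncomputable def ukfW (n : ℕ) (α : ℝ) : Fin (2*n+1) → ℝ :=
  fun i => if i.val = 0 then (α^2 - 1)/α^2 else 1/(2*α^2*n)

/-- Perturbation matrix `Δ(α, B)`: first column 0, next n columns `α·bᵢ`,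
last n columns `−α·bᵢ`. -/
noncomputable def ukfDelta (n : ℕ) (α : ℝ) (B : Matrix (Fin n) (Fin n) ℝ) :
    Matrix (Fin n) (Fin (2*n+1)) ℝ :=
  Matrix.of fun i j =>
    if h0 : j.val = 0 then 0
    else if h1 : j.val ≤ n then α * B i ⟨j.val - 1, by omega⟩
    else -(α * B i ⟨j.val - n - 1, by have := j.isLt; omega⟩)

/-- Sigma-point matrix `X(x̂, α, B)`: j-th column is `x̂` plus the j-th column of `Δ(α, B)`. -/
noncomputable def sigmaPts {n : ℕ} (xhat : Fin n → ℝ) (α : ℝ)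
    (B : Matrix (Fin n) (Fin n) ℝ) : Matrix (Fin n) (Fin (2*n+1)) ℝ :=
  Matrix.of fun i j => xhat i + ukfDelta n α B i j

/-- Affine propagation of an ensemble: j-th column of the result is `A·(j-th column of X) + u`. -/
noncomputable def propagate {n : ℕ} (A : Matrix (Fin n) (Fin n) ℝ) (u : Fin n → ℝ)
    (X : Matrix (Fin n) (Fin (2*n+1)) ℝ) : Matrix (Fin n) (Fin (2*n+1)) ℝ :=
  Matrix.of fun i j => A.mulVec (fun r => X r j) i + u i

/-- Deviation matrix `X̃ = X − (X·W)·1ᵀ`. -/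
noncomputable def devMat {q m : ℕ} (w : Fin m → ℝ) (X : Matrix (Fin q) (Fin m) ℝ) :
    Matrix (Fin q) (Fin m) ℝ :=
  X - Matrix.vecMulVec (X.mulVec w) (fun _ => 1)

/-- Posterior covariance as a function of the gain:
`P(K̂) = P_prior + K̂·R̄·K̂ᵀ − K̂·C·P_prior − P_prior·Cᵀ·K̂ᵀ`. -/
noncomputable def postCov {n p : ℕ} (Pprior : Matrix (Fin n) (Fin n) ℝ)
    (C : Matrix (Fin p) (Fin n) ℝ) (Rbar : Matrix (Fin p) (Fin p) ℝ)
    (K : Matrix (Fin n) (Fin p) ℝ) : Matrix (Fin n) (Fin n) ℝ :=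
  Pprior + K * Rbar * Kᵀ - K * C * Pprior - Pprior * Cᵀ * Kᵀ

theorem sum_fin_two_mul_add_one {M : Type*} [AddCommMonoid M] {n : ℕ} (f : Fin (2*n+1) → M) :
    ∑ j, f j = f 0 + (∑ i : Fin n, f ⟨i + 1, by omega⟩ + ∑ i : Fin n, f ⟨n + i + 1, by omega⟩) := by
  have e : n + n = 2 * n := by omega
  rw [Fin.sum_univ_succ, ← (finCongr e).sum_comp, Fin.sum_univ_add]
  rfl

section SigmaPoints

variable {n : ℕ} {α : ℝ}

theorem ukfW_zero : ukfW n α 0 = (α^2 - 1)/α^2 := by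
  simp [ukfW]

theorem ukfW_succ (k : ℕ) (h : k + 1 < 2*n+1) : ukfW n α ⟨k + 1, h⟩ = 1/(2*α^2*n) := by
  simp [ukfW]

theorem ukfDelta_zero (B : Matrix (Fin n) (Fin n) ℝ) (i : Fin n) : ukfDelta n α B i 0 = 0 := by
  simp [ukfDelta]

theorem ukfDelta_pos (B : Matrix (Fin n) (Fin n) ℝ) (i k : Fin n) :
    ukfDelta n α B i ⟨k + 1, by omega⟩ = α * B i k := by
  have : (k : ℕ) + 1 ≤ n := k.isLt
  simp [ukfDelta, this]

theorem ukfDelta_neg (B : Matrix (Fin n) (Fin n) ℝ) (i k : Fin n) :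
    ukfDelta n α B i ⟨n + k + 1, by omega⟩ = -(α * B i k) := by
  have h : ¬ n + (k : ℕ) + 1 ≤ n := by omega
  have h' : n + (k : ℕ) + 1 - n - 1 = k := by omega
  simp [ukfDelta, h, h']

theorem sum_ukfW (hn : 0 < n) (hα : α ≠ 0) : ∑ j, ukfW n α j = 1 := by
  have hn' : (n : ℝ) ≠ 0 := by positivity
  simp only [sum_fin_two_mul_add_one, ukfW_zero, ukfW_succ, Finset.sum_const, Finset.card_univ,
    Fintype.card_fin, nsmul_eq_mul]
  field_simp
  ring

theorem ukfDelta_mulVec_ukfW (B : Matrix (Fin n) (Fin n) ℝ) :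
    ukfDelta n α B *ᵥ ukfW n α = 0 := by
  ext i
  simp only [mulVec, dotProduct, sum_fin_two_mul_add_one, ukfW_succ, ukfDelta_zero, ukfDelta_pos,
    ukfDelta_neg, neg_mul, Finset.sum_neg_distrib, Pi.zero_apply]
  ring

theorem ukfDelta_mul_diagonal_mul_transpose (hα : α ≠ 0) (B : Matrix (Fin n) (Fin n) ℝ) :
    ukfDelta n α B * diagonal (ukfW n α) * (ukfDelta n α B)ᵀ = (n : ℝ)⁻¹ • (B * Bᵀ) := by
  ext i k
  simp only [mul_apply (M := _ * diagonal _), mul_diagonal, transpose_apply,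
    sum_fin_two_mul_add_one, ukfW_succ, ukfDelta_zero, ukfDelta_pos, ukfDelta_neg, Matrix.smul_apply,
    mul_apply (M := B), smul_eq_mul, Finset.mul_sum, zero_mul, zero_add, ← Finset.sum_add_distrib]
  refine Finset.sum_congr rfl fun l _ => ?_
  field_simp
  ring

theorem propagate_sigmaPts (A B : Matrix (Fin n) (Fin n) ℝ) (u xhat : Fin n → ℝ) :
    propagate A u (sigmaPts xhat α B) =
      vecMulVec (A *ᵥ xhat + u) (fun _ => 1) + A * ukfDelta n α B := by
  ext i j
  simp only [propagate, sigmaPts, of_apply, mulVec, dotProduct, mul_add, Finset.sum_add_distrib,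
    Matrix.add_apply, vecMulVec_apply, Pi.add_apply, mul_one, mul_apply]
  ring

theorem devMat_vecMulVec_add_mul {q m r : ℕ} {w : Fin m → ℝ} (hw : ∑ j, w j = 1)
    {D : Matrix (Fin r) (Fin m) ℝ} (hD : D *ᵥ w = 0) (c : Fin q → ℝ)
    (M : Matrix (Fin q) (Fin r) ℝ) :
    devMat w (vecMulVec c (fun _ => 1) + M * D) = M * D := by
  have h : vecMulVec c (fun _ => 1) *ᵥ w = c := by
    ext i
    simp [mulVec, dotProduct, vecMulVec_apply, ← Finset.mul_sum, hw]
  rw [devMat, add_mulVec, ← mulVec_mulVec, hD, mulVec_zero, add_zero, h, add_sub_cancel_left]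

end SigmaPoints

theorem stmt18 {n p : ℕ} (hn : 0 < n) (hp : 0 < p)
    (A : Matrix (Fin n) (Fin n) ℝ) (C : Matrix (Fin p) (Fin n) ℝ)
    (Q P : Matrix (Fin n) (Fin n) ℝ) (R : Matrix (Fin p) (Fin p) ℝ)
    (hQ : Q.PosSemidef) (hR : R.PosDef) (hP : P.PosSemidef)
    (xhat u : Fin n → ℝ) (α : ℝ) (hα : α ≠ 0)
    (Pprior : Matrix (Fin n) (Fin n) ℝ) (hPprior : Pprior = A * P * Aᵀ + Q)
    (Rbar : Matrix (Fin p) (Fin p) ℝ) (hRbar : Rbar = C * Pprior * Cᵀ + R)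
    (B : Matrix (Fin n) (Fin n) ℝ) (hB : B * Bᵀ = (n : ℝ) • P)
    (X' : Matrix (Fin n) (Fin (2*n+1)) ℝ) (hX' : X' = propagate A u (sigmaPts xhat α B))
    (Xt : Matrix (Fin n) (Fin (2*n+1)) ℝ) (hXt : Xt = devMat (ukfW n α) X')
    (Yt : Matrix (Fin p) (Fin (2*n+1)) ℝ) (hYt : Yt = devMat (ukfW n α) (C * X'))
    (PpC : Matrix (Fin n) (Fin n) ℝ)
    (hPpC : PpC = Xt * Matrix.diagonal (ukfW n α) * Xtᵀ + Q)
    (PzC : Matrix (Fin p) (Fin p) ℝ)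
    (hPzC : PzC = Yt * Matrix.diagonal (ukfW n α) * Ytᵀ + C * Q * Cᵀ + R)
    (PezC : Matrix (Fin n) (Fin p) ℝ)
    (hPezC : PezC = Xt * Matrix.diagonal (ukfW n α) * Ytᵀ + Q * Cᵀ) :
    PpC = Pprior ∧
    PzC = C * Pprior * Cᵀ + R ∧
    PezC = Pprior * Cᵀ := by
  have hn' : (n : ℝ) ≠ 0 := by positivity
  have hcov : ukfDelta n α B * diagonal (ukfW n α) * (ukfDelta n α B)ᵀ = P := by
    rw [ukfDelta_mul_diagonal_mul_transpose hα, hB, inv_smul_smul₀ hn']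
  have hcov_congr (q r : ℕ) (M : Matrix (Fin q) (Fin n) ℝ) (N : Matrix (Fin r) (Fin n) ℝ) :
      M * ukfDelta n α B * diagonal (ukfW n α) * (N * ukfDelta n α B)ᵀ = M * P * Nᵀ := by
    rw [← hcov]
    simp only [transpose_mul, Matrix.mul_assoc]
  have hX : Xt = A * ukfDelta n α B := by
    rw [hXt, hX', propagate_sigmaPts,
      devMat_vecMulVec_add_mul (sum_ukfW hn hα) (ukfDelta_mulVec_ukfW B)]
  have hY : Yt = C * A * ukfDelta n α B := by
    rw [hYt, hX', propagate_sigmaPts, Matrix.mul_add, mul_vecMulVec, ← Matrix.mul_assoc,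
      devMat_vecMulVec_add_mul (sum_ukfW hn hα) (ukfDelta_mulVec_ukfW B)]
  refine ⟨?_, ?_, ?_⟩
  · rw [hPpC, hX, hcov_congr, hPprior]
  · rw [hPzC, hY, hcov_congr, hPprior]
    simp only [transpose_mul, Matrix.mul_add, Matrix.add_mul, Matrix.mul_assoc]
  · rw [hPezC, hX, hY, hcov_congr, hPprior]
    simp only [transpose_mul, Matrix.add_mul, Matrix.mul_assoc]
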